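/- arXiv:1402.7328 — 2 statements merged into one kernel-verified Lean document; each statement's English description precedes it below -/
import Mathlib

section
/- Let ψ satisfy the standard assumptions plus superlinearity (ψ(x)/x→∞ as x→∞) and zero derivative at 0 (ψ(x)/x→0 as x→0). Let (X,τ,d) be an extended Polish space and u:[0,T]→X a curve that is right continuous at every point w.r.t. d and continuous except at most a countable set. If limsup_{h→0⁺} ‖d(u(·+h),u(·))/h‖_{L^ψ(0,T)} < ∞ (extending u(t)=u(T) for t>T), then u is absolutely continuous with L^ψ metric speed, i.e. there exists m ∈ L^ψ(0,T) with d(u(s),u(t)) ≤ ∫_s^t m(r)dr for all s ≤ t. -/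
open MeasureTheory Filter Set ENNReal NNReal Topology

noncomputable section

/-- Luxemburg (Orlicz) norm of a nonnegative function. -/
def luxNorm (ψ : ℝ≥0∞ → ℝ≥0∞) {Ω : Type*} [MeasurableSpace Ω]
    (ν : Measure Ω) (u : Ω → ℝ≥0∞) : ℝ≥0∞ :=
  sInf {l : ℝ≥0∞ | 0 < l ∧ ∫⁻ x, ψ (u x / l) ∂ν ≤ 1}

/-- Standard assumptions on the Orlicz function `ψ`: convex, lower semicontinuous,
non-decreasing, `ψ 0 = 0`, `ψ x → ∞` as `x → ∞`. -/
structure IsOrlicz (ψ : ℝ≥0∞ → ℝ≥0∞) : Prop where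
  convex : ∀ a b x y : ℝ≥0∞, a + b = 1 → ψ (a * x + b * y) ≤ a * ψ x + b * ψ y
  lsc : LowerSemicontinuous ψ
  mono : Monotone ψ
  zero : ψ 0 = 0
  tendsto_top : ∀ C : ℝ≥0∞, ∃ M : ℝ≥0∞, ∀ x, M ≤ x → C ≤ ψ x

/-- Superlinearity at infinity: `ψ x / x → ∞`. -/
def Superlinear (ψ : ℝ≥0∞ → ℝ≥0∞) : Prop :=
  ∀ C : ℝ≥0, ∃ M : ℝ≥0, ∀ x : ℝ≥0, M ≤ x → (C : ℝ≥0∞) * x ≤ ψ x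

/-- Null right derivative at `0`: `ψ x / x → 0` as `x → 0⁺`. -/
def FlatAtZero (ψ : ℝ≥0∞ → ℝ≥0∞) : Prop :=
  ∀ ε : ℝ≥0, 0 < ε → ∃ δ : ℝ≥0, 0 < δ ∧ ∀ x : ℝ≥0, 0 < x → x ≤ δ → ψ x ≤ (ε : ℝ≥0∞) * x

/-- Legendre conjugate `ψ*(y) = sup_{x ≥ 0} (x y - ψ x)`. -/
def conjOrlicz (ψ : ℝ≥0∞ → ℝ≥0∞) (y : ℝ≥0∞) : ℝ≥0∞ :=
  ⨆ x : ℝ≥0, (x : ℝ≥0∞) * y - ψ x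

/-- Generalized inverse of `ψ` (with the convention of the paper). -/
def psiInv (ψ : ℝ≥0∞ → ℝ≥0∞) (s : ℝ≥0∞) : ℝ≥0∞ :=
  sSup {r : ℝ≥0∞ | ψ r ≤ s}

/-- `(X, τ, d)` is an extended Polish space: `d` is an extended distance, complete,
`d`-convergence implies `τ`-convergence, and `d` is `τ × τ` lower semicontinuous. -/
structure IsExtPolish (X : Type*) [TopologicalSpace X] (d : X → X → ℝ≥0∞) : Prop where
  symm : ∀ x y, d x y = d y x
  eq_zero_iff : ∀ x y, d x y = 0 ↔ x = y
  triangle : ∀ x y z, d x z ≤ d x y + d y z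
  complete : ∀ u : ℕ → X,
    (∀ ε : ℝ≥0∞, 0 < ε → ∃ N, ∀ m n, N ≤ m → N ≤ n → d (u m) (u n) < ε) →
    ∃ x, Tendsto (fun n => d (u n) x) atTop (𝓝 0)
  compat : ∀ (u : ℕ → X) (x : X),
    Tendsto (fun n => d (u n) x) atTop (𝓝 0) → Tendsto u atTop (𝓝 x)
  lsc : LowerSemicontinuous fun p : X × X => d p.1 p.2

/-- Admissible transport plans between `μ` and `ν`. -/
def Couplings {X : Type*} [MeasurableSpace X] (μ ν : Measure X) : Set (Measure (X × X)) :=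
  {γ | IsProbabilityMeasure γ ∧ γ.map Prod.fst = μ ∧ γ.map Prod.snd = ν}

/-- The Wasserstein–Orlicz extended distance. -/
def Wass (ψ : ℝ≥0∞ → ℝ≥0∞) {X : Type*} [MeasurableSpace X] (d : X → X → ℝ≥0∞)
    (μ ν : Measure X) : ℝ≥0∞ :=
  ⨅ γ ∈ Couplings μ ν, luxNorm ψ γ (fun p : X × X => d p.1 p.2)

/-- Absolutely continuous curve with finite `L^ψ` energy with respect to the
extended distance `ρ`, on the interval `[a, b]`. -/
def IsACpsi (ψ : ℝ≥0∞ → ℝ≥0∞) {A : Type*} (ρ : A → A → ℝ≥0∞)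
    (a b : ℝ) (u : ℝ → A) : Prop :=
  ∃ m : ℝ → ℝ≥0∞, luxNorm ψ (volume.restrict (Set.Icc a b)) m < ⊤ ∧
    ∀ s t : ℝ, a ≤ s → s ≤ t → t ≤ b → ρ (u s) (u t) ≤ ∫⁻ r in Set.Icc s t, m r

/-- The metric derivative of the curve `u` (with values in a space with extended
distance `ρ`) at time `t` within the interval `I` equals `L`. -/
def HasMDeriv {A : Type*} (ρ : A → A → ℝ≥0∞) (u : ℝ → A) (I : Set ℝ) (t : ℝ)
    (L : ℝ≥0∞) : Prop :=
  Tendsto (fun h : ℝ => ρ (u (t + h)) (u t) / ENNReal.ofReal |h|)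
    (𝓝[{h : ℝ | h ≠ 0 ∧ t + h ∈ I}] 0) (𝓝 L)

/-- The support of a Borel measure. -/
def measSupport {Y : Type*} [TopologicalSpace Y] [MeasurableSpace Y] (μ : Measure Y) : Set Y :=
  {y | ∀ U ∈ 𝓝 y, 0 < μ U}


theorem aux_aemeas {X : Type*} (d : X → X → ℝ≥0∞) (hsymm : ∀ x y, d x y = d y x)
    (htri : ∀ x y z, d x z ≤ d x y + d y z) (v : ℝ → X) (S : Set ℝ) (hS : S.Countable)
    (hc : ∀ t, t ∉ S → Tendsto (fun s => d (v s) (v t)) (𝓝 t) (𝓝 0)) (h : ℝ) :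
    AEMeasurable (fun t => d (v (t + h)) (v t)) (volume : Measure ℝ) := by
  have hS2 : ((fun t : ℝ => t + h) ⁻¹' S).Countable := hS.preimage (add_left_injective h)
  set A : Set ℝ := (S ∪ (fun t : ℝ => t + h) ⁻¹' S)ᶜ with hA
  have hAc : (S ∪ (fun t : ℝ => t + h) ⁻¹' S).Countable := hS.union hS2
  have hcont : ContinuousOn (fun t => d (v (t + h)) (v t)) A := by
    intro t ht
    apply ContinuousAt.continuousWithinAt
    have ht1 : t ∉ S := fun h' => ht (Or.inl h')
    have ht2 : t + h ∉ S := fun h' => ht (Or.inr h')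
    have e1 := hc t ht1
    have e2 : Tendsto (fun s => d (v (s + h)) (v (t + h))) (𝓝 t) (𝓝 0) :=
      (hc (t + h) ht2).comp ((continuous_add_const h).tendsto t)
    have e := e2.add e1
    rw [add_zero] at e
    have lo : Tendsto (fun s => d (v (t + h)) (v t) - (d (v (s + h)) (v (t + h)) + d (v s) (v t)))
        (𝓝 t) (𝓝 (d (v (t + h)) (v t))) := by
      simpa using ENNReal.Tendsto.sub (tendsto_const_nhds (x := d (v (t + h)) (v t))) e
        (Or.inr ENNReal.zero_ne_top)
    have hi : Tendsto (fun s => d (v (t + h)) (v t) + (d (v (s + h)) (v (t + h)) + d (v s) (v t)))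
        (𝓝 t) (𝓝 (d (v (t + h)) (v t))) := by
      simpa using (tendsto_const_nhds (x := d (v (t + h)) (v t))).add e
    refine tendsto_of_tendsto_of_tendsto_of_le_of_le lo hi ?_ ?_
    · intro s
      simp only
      rw [tsub_le_iff_right]
      calc d (v (t + h)) (v t) ≤ d (v (t + h)) (v (s + h)) + d (v (s + h)) (v t) := htri _ _ _
        _ ≤ d (v (t + h)) (v (s + h)) + (d (v (s + h)) (v s) + d (v s) (v t)) := by
            gcongr; exact htri _ _ _
        _ = _ := by rw [hsymm (v (t + h))]; ring
    · intro s
      simp only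
      calc d (v (s + h)) (v s) ≤ d (v (s + h)) (v (t + h)) + d (v (t + h)) (v s) := htri _ _ _
        _ ≤ d (v (s + h)) (v (t + h)) + (d (v (t + h)) (v t) + d (v t) (v s)) := by
            gcongr; exact htri _ _ _
        _ = _ := by rw [hsymm (v t)]; ring
  have hm := hcont.aemeasurable (μ := (volume : Measure ℝ)) hAc.measurableSet.compl
  rwa [Measure.restrict_eq_self_of_ae_mem] at hm
  exact hAc.ae_notMem _

theorem aux_shift (g : ℝ → ℝ≥0∞) (a h : ℝ) (hh : 0 ≤ h) (N : ℕ) :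
    ∑ i ∈ Finset.range N, ∫⁻ s in Ioc a (a + h), g (s + i * h) = ∫⁻ s in Ioc a (a + N * h), g s := by
  induction N with
  | zero => simp
  | succ N ih =>
    rw [Finset.sum_range_succ, ih]
    have hN : 0 ≤ (N : ℝ) * h := by positivity
    have e1 : Ioc a (a + (N + 1 : ℕ) * h) = Ioc a (a + N * h) ∪ Ioc (a + N * h) (a + (N + 1 : ℕ) * h) := by
      rw [Ioc_union_Ioc_eq_Ioc] <;> push_cast <;> linarith
    rw [e1, lintegral_union measurableSet_Ioc]
    · congr 1
      have := (measurePreserving_add_right (volume : Measure ℝ) (N * h)).setLIntegral_comp_preimage_emb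
        (MeasurableEquiv.addRight ((N : ℝ) * h)).measurableEmbedding g
        (Ioc (a + N * h) (a + (N + 1 : ℕ) * h))
      rw [← this]
      congr 2
      ext x
      simp only [mem_Ioc, mem_preimage]
      push_cast
      constructor <;> rintro ⟨p, q⟩ <;> constructor <;> linarith
    · rw [Set.disjoint_left]
      rintro x ⟨_, p⟩ ⟨q, _⟩
      linarith

theorem aux_chain {X : Type*} (d : X → X → ℝ≥0∞) (h0 : ∀ x, d x x = 0)
    (hsymm : ∀ x y, d x y = d y x)
    (htri : ∀ x y z, d x z ≤ d x y + d y z) (v : ℝ → X) (s h : ℝ) (N : ℕ) :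
    d (v s) (v (s + N * h)) ≤ ∑ i ∈ Finset.range N, d (v (s + i * h + h)) (v (s + i * h)) := by
  induction N with
  | zero => simp [h0]
  | succ N ih =>
    rw [Finset.sum_range_succ]
    refine (htri _ (v (s + N * h)) _).trans ?_
    gcongr
    rw [hsymm]
    apply le_of_eq
    congr 2
    push_cast; ring

theorem aux_equi (ψ : ℝ≥0∞ → ℝ≥0∞) (hψ : IsOrlicz ψ) (hsl : Superlinear ψ) (L : ℝ≥0) (hL : 0 < L)
    (C : ℝ≥0) (hC : 0 < C) : ∃ M : ℝ≥0, ∀ (g : ℝ → ℝ≥0∞) (E : Set ℝ),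
      ∫⁻ x in E, ψ (g x / L) ≤ 1 → ∫⁻ x in E, g x ≤ (L * M : ℝ≥0) * volume E + (L / C : ℝ≥0) := by
  obtain ⟨M, hM⟩ := hsl C
  refine ⟨M, fun g E hg => ?_⟩
  have hL0 : (L : ℝ≥0∞) ≠ 0 := by exact_mod_cast hL.ne'
  have hC0 : (C : ℝ≥0∞) ≠ 0 := by exact_mod_cast hC.ne'
  have htop : ψ ⊤ = ⊤ := by
    obtain ⟨M', h'⟩ := hψ.tendsto_top ⊤
    exact top_le_iff.1 (h' ⊤ le_top)
  have key : ∀ y : ℝ≥0∞, y ≤ M + ψ y / C := by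
    intro y
    induction y with
    | top => rw [htop, ENNReal.top_div_of_ne_top coe_ne_top]; simp
    | coe y =>
      rcases le_total M y with h | h
      · refine le_trans ?_ le_add_self
        rw [ENNReal.le_div_iff_mul_le (Or.inl hC0) (Or.inl coe_ne_top), mul_comm]
        exact hM y h
      · refine le_trans ?_ le_self_add
        exact_mod_cast h
  have key2 : ∀ x, g x ≤ (L * M : ℝ≥0) + (L / C : ℝ≥0) * ψ (g x / L) := by
    intro x
    have := mul_le_mul_right (key (g x / L)) (L : ℝ≥0∞)
    rw [ENNReal.mul_div_cancel hL0 coe_ne_top] at this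
    refine this.trans (le_of_eq ?_)
    rw [mul_add, ENNReal.coe_mul, ENNReal.coe_div hC.ne']
    simp only [div_eq_mul_inv]
    ring
  calc ∫⁻ x in E, g x ≤ ∫⁻ x in E, ((L * M : ℝ≥0) + (L / C : ℝ≥0) * ψ (g x / L)) :=
        lintegral_mono key2
    _ = (L * M : ℝ≥0) * volume E + (L / C : ℝ≥0) * ∫⁻ x in E, ψ (g x / L) := by
        rw [lintegral_add_left measurable_const, lintegral_const_mul' _ _ coe_ne_top]
        simp
    _ ≤ _ := by
        gcongr
        exact mul_le_of_le_one_right' hg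

theorem aux_lsc (ψ : ℝ≥0∞ → ℝ≥0∞) (hψ : IsOrlicz ψ) (a : ℕ → ℝ≥0∞) :
    ψ (liminf a atTop) ≤ liminf (fun n => ψ (a n)) atTop := by
  rw [liminf_eq_iSup_iInf_of_nat]
  apply le_of_forall_lt
  intro c hc
  have hmono : Monotone (fun n => ⨅ i ≥ n, a i) := by
    intro n m hnm
    refine le_iInf₂ fun i hi => iInf₂_le i (le_trans hnm hi)
  have ht := tendsto_atTop_iSup hmono
  obtain ⟨c', hc', hc'2⟩ := exists_between hc
  have := ht.eventually (hψ.lsc _ c' hc'2)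
  refine lt_of_lt_of_le hc' (le_liminf_of_le (by isBoundedDefault) ?_)
  filter_upwards [this] with n hn
  exact hn.le.trans (hψ.mono (iInf₂_le n le_rfl))

theorem aux_right {X : Type*} (d : X → X → ℝ≥0∞) (v : ℝ → X) (t : ℝ)
    (hrc : Tendsto (fun s => d (v s) (v t)) (𝓝[>] t) (𝓝 0)) (η : ℝ≥0∞) (hη : 0 < η) :
    ∃ δ > 0, ∀ s, t < s → s < t + δ → d (v s) (v t) < η := by
  have h1 : {s | d (v s) (v t) < η} ∈ 𝓝[>] t := hrc (Iio_mem_nhds hη)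
  rw [mem_nhdsGT_iff_exists_Ioo_subset] at h1
  obtain ⟨w, hw, hsub⟩ := h1
  rw [mem_Ioi] at hw
  refine ⟨w - t, by linarith, fun s h1 h2 => hsub ⟨h1, by linarith⟩⟩

theorem aux_key {X : Type*} (d : X → X → ℝ≥0∞) (h0 : ∀ x, d x x = 0)
    (hsymm : ∀ x y, d x y = d y x)
    (htri : ∀ x y z, d x z ≤ d x y + d y z) (v : ℝ → X)
    (hm : ∀ h, AEMeasurable (fun t => d (v (t + h)) (v t)) (volume : Measure ℝ))
    (hrc : ∀ t, 0 ≤ t → Tendsto (fun s => d (v s) (v t)) (𝓝[>] t) (𝓝 0))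
    (ψ : ℝ≥0∞ → ℝ≥0∞) (hψ : IsOrlicz ψ) (hsl : Superlinear ψ) (L : ℝ≥0) (hL : 0 < L)
    (hpsi : ∀ᶠ h : ℝ in 𝓝[>] 0,
      ∫⁻ x in Ioi (0 : ℝ), ψ (d (v (x + h)) (v x) / ENNReal.ofReal h / L) ≤ 1)
    (a b : ℝ) (ha : 0 ≤ a) (hab : a ≤ b) (η : ℝ≥0) (hη : 0 < η) :
    ∀ᶠ h : ℝ in 𝓝[>] 0, d (v a) (v b) ≤
      (∫⁻ x in Ioc a b, d (v (x + h)) (v x) / ENNReal.ofReal h) + η := by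
  have hη4 : 0 < η / 4 := by positivity
  have hη4' : (0 : ℝ≥0∞) < (η / 4 : ℝ≥0) := by exact_mod_cast hη4
  obtain ⟨δ₁, hδ₁, H1⟩ := aux_right d v a (hrc a ha) _ hη4'
  obtain ⟨δ₂, hδ₂, H2⟩ := aux_right d v b (hrc b (ha.trans hab)) _ hη4'
  obtain ⟨M, hM⟩ := aux_equi ψ hψ hsl L hL (L / (η / 4)) (by positivity)
  have hLC : L / (L / (η / 4)) = η / 4 := by field_simp
  rw [hLC] at hM
  have hsmall : ∀ᶠ h : ℝ in 𝓝[>] 0, (L * M : ℝ≥0) * ENNReal.ofReal h < (η / 4 : ℝ≥0) := by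
    have : Tendsto (fun h : ℝ => (L * M : ℝ≥0) * ENNReal.ofReal h) (𝓝 0) (𝓝 0) := by
      have := ENNReal.Tendsto.const_mul (a := ((L * M : ℝ≥0) : ℝ≥0∞))
        (ENNReal.tendsto_ofReal (tendsto_id (x := 𝓝 (0 : ℝ)))) (Or.inr coe_ne_top)
      simpa using this
    exact (this.mono_left nhdsWithin_le_nhds) (Iio_mem_nhds hη4')
  have hh1 : ∀ᶠ h : ℝ in 𝓝[>] 0, h ∈ Ioo 0 δ₁ := Ioo_mem_nhdsGT hδ₁
  have hh2 : ∀ᶠ h : ℝ in 𝓝[>] 0, h ∈ Ioo 0 (δ₂ / 2) := Ioo_mem_nhdsGT (by linarith)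
  filter_upwards [hpsi, hsmall, hh1, hh2] with h hp hs ⟨hpos, h1⟩ ⟨_, h2⟩
  set f : ℝ → ℝ≥0∞ := fun x => d (v (x + h)) (v x) / ENNReal.ofReal h with hf
  have hh0 : ENNReal.ofReal h ≠ 0 := by simpa using hpos
  have hfm : AEMeasurable f volume := (hm h).div_const _
  have hfD : ∀ x, d (v (x + h)) (v x) = ENNReal.ofReal h * f x := fun x =>
    (ENNReal.mul_div_cancel hh0 ofReal_ne_top).symm
  set N := ⌈(b - a) / h⌉₊ with hN
  have hN1 : b ≤ a + N * h := by
    have := Nat.le_ceil ((b - a) / h)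
    rw [div_le_iff₀ hpos] at this
    linarith
  have hN2 : a + N * h < b + h := by
    have := Nat.ceil_lt_add_one (a := (b - a) / h) (div_nonneg (by linarith) hpos.le)
    rw [← sub_lt_iff_lt_add, lt_div_iff₀ hpos] at this
    linarith
  have hpt : ∀ s ∈ Ioc a (a + h), d (v a) (v b) ≤
      (η / 4 : ℝ≥0) + (η / 4 : ℝ≥0) + ENNReal.ofReal h * ∑ i ∈ Finset.range N, f (s + i * h) := by
    rintro s ⟨hs1, hs2⟩
    have e1 := H1 s hs1 (by linarith)
    have e2 := H2 (s + N * h) (by linarith) (by linarith)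
    have e3 := aux_chain d h0 hsymm htri v s h N
    calc d (v a) (v b) ≤ d (v a) (v s) + d (v s) (v b) := htri _ _ _
      _ ≤ d (v a) (v s) + (d (v s) (v (s + N * h)) + d (v (s + N * h)) (v b)) := by
          gcongr; exact htri _ _ _
      _ ≤ (η / 4 : ℝ≥0) + ((∑ i ∈ Finset.range N, d (v (s + i * h + h)) (v (s + i * h)))
            + (η / 4 : ℝ≥0)) := by
          rw [hsymm (v a)]
          gcongr
      _ = _ := by
          simp_rw [hfD, Finset.mul_sum]
          ring
  have hshift := aux_shift f a h hpos.le N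
  have hint : d (v a) (v b) ≤ (η / 4 : ℝ≥0) + (η / 4 : ℝ≥0) + ∫⁻ s in Ioc a (a + N * h), f s := by
    have hI := setLIntegral_mono_ae' (μ := volume) (s := Ioc a (a + h)) measurableSet_Ioc
      (ae_of_all _ hpt)
    rw [lintegral_add_left measurable_const, lintegral_const_mul' _ _ ofReal_ne_top,
      lintegral_finsetSum', hshift] at hI
    · simp only [lintegral_const, Measure.restrict_apply_univ, Real.volume_Ioc,
        add_sub_cancel_left] at hI
      rw [mul_comm _ (ENNReal.ofReal h), mul_comm _ (ENNReal.ofReal h), ← mul_add] at hI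
      exact (ENNReal.mul_le_mul_iff_right hh0 ofReal_ne_top).1 hI
    · intro i _
      exact (hfm.comp_quasiMeasurePreserving
        (measurePreserving_add_right (volume : Measure ℝ) (i * h)).quasiMeasurePreserving).restrict
  have hsplit : ∫⁻ s in Ioc a (a + N * h), f s ≤ (∫⁻ s in Ioc a b, f s) + ((η / 4 : ℝ≥0) + (η / 4 : ℝ≥0)) := by
    rw [← Ioc_union_Ioc_eq_Ioc hab hN1]
    refine (lintegral_union_le _ _ _).trans ?_
    gcongr
    refine (hM f _ ?_).trans ?_
    · refine le_trans (lintegral_mono_set ?_) hp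
      intro x hx
      exact lt_of_le_of_lt (ha.trans hab) hx.1
    · gcongr
      refine le_trans ?_ hs.le
      gcongr
      rw [Real.volume_Ioc]
      apply ENNReal.ofReal_le_ofReal
      linarith
  refine hint.trans ((add_le_add_right hsplit _).trans (le_of_eq ?_))
  have : (η : ℝ≥0∞) = (η / 4 : ℝ≥0) + (η / 4 : ℝ≥0) + (η / 4 : ℝ≥0) + (η / 4 : ℝ≥0) := by
    norm_cast
    ring
  rw [this]
  ring

theorem aux_ac {X : Type*} (d : X → X → ℝ≥0∞)
    (hsymm : ∀ x y, d x y = d y x)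
    (htri : ∀ x y z, d x z ≤ d x y + d y z) (v : ℝ → X)
    (ψ : ℝ≥0∞ → ℝ≥0∞) (hψ : IsOrlicz ψ) (hsl : Superlinear ψ) (L : ℝ≥0) (hL : 0 < L)
    (hpsi : ∀ᶠ h : ℝ in 𝓝[>] 0,
      ∫⁻ x in Ioi (0 : ℝ), ψ (d (v (x + h)) (v x) / ENNReal.ofReal h / L) ≤ 1)
    (hkey : ∀ (a b : ℝ), 0 ≤ a → a ≤ b → ∀ η : ℝ≥0, 0 < η →
      ∀ᶠ h : ℝ in 𝓝[>] 0, d (v a) (v b) ≤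
      (∫⁻ x in Ioc a b, d (v (x + h)) (v x) / ENNReal.ofReal h) + η)
    (s t : ℝ) (hs : 0 ≤ s) (hst : s ≤ t) :
    (∀ x y, 0 ≤ x → 0 ≤ y → d (v x) (v y) ≠ ⊤) ∧
    AbsolutelyContinuousOnInterval (fun x => (d (v s) (v x)).toReal) s t := by
  have hfin' : ∀ x y, 0 ≤ x → x ≤ y → d (v x) (v y) ≠ ⊤ := by
    intro x y hx hxy
    obtain ⟨M, hM⟩ := aux_equi ψ hψ hsl L hL 1 one_pos
    obtain ⟨h, hh1, hh2⟩ := (hpsi.and (hkey x y hx hxy 1 one_pos)).exists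
    have := hM (fun x => d (v (x + h)) (v x) / ENNReal.ofReal h) (Ioc x y)
      (le_trans (lintegral_mono_set fun z hz => lt_of_le_of_lt hx hz.1) hh1)
    refine ne_top_of_le_ne_top ?_ (hh2.trans (add_le_add_left this _))
    rw [Real.volume_Ioc]
    finiteness
  have hfin : ∀ x y, 0 ≤ x → 0 ≤ y → d (v x) (v y) ≠ ⊤ := by
    intro x y hx hy
    rcases le_total x y with h | h
    · exact hfin' x y hx h
    · rw [hsymm]; exact hfin' y x hy h
  refine ⟨hfin, ?_⟩
  rw [absolutelyContinuousOnInterval_iff]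
  intro ε hε
  lift ε to ℝ≥0 using hε.le
  have hε : 0 < ε := by exact_mod_cast hε
  obtain ⟨M, hM⟩ := aux_equi ψ hψ hsl L hL (L / (ε / 4)) (by positivity)
  have hLC : L / (L / (ε / 4)) = ε / 4 := by field_simp
  rw [hLC] at hM
  refine ⟨ε / 4 / (L * M + 1), by positivity, ?_⟩
  rintro ⟨n, I⟩ hE hlen
  simp only at hlen ⊢
  obtain ⟨hE1, hE2⟩ := hE
  simp only [Finset.mem_range, uIcc_of_le hst] at hE1
  simp only at hE2
  set A : ℕ → ℝ := fun i => min (I i).1 (I i).2 with hA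
  set B : ℕ → ℝ := fun i => max (I i).1 (I i).2 with hB
  have hAB : ∀ i, A i ≤ B i := fun i => min_le_max
  have hA0 : ∀ i ∈ Finset.range n, 0 ≤ A i := fun i hi =>
    le_min (hs.trans (hE1 i (Finset.mem_range.1 hi)).1.1) (hs.trans (hE1 i (Finset.mem_range.1 hi)).2.1)
  have hdAB : ∀ i, d (v (I i).1) (v (I i).2) = d (v (A i)) (v (B i)) := by
    intro i
    rcases le_total (I i).1 (I i).2 with h | h
    · simp [hA, hB, h]
    · simp [hA, hB, h, hsymm (v (I i).1)]
  set η : ℝ≥0 := ε / 4 / (n + 1) with hη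
  have hηpos : 0 < η := by positivity
  have hev : ∀ᶠ h : ℝ in 𝓝[>] 0, ∀ i ∈ Finset.range n, d (v (A i)) (v (B i)) ≤
      (∫⁻ x in Ioc (A i) (B i), d (v (x + h)) (v x) / ENNReal.ofReal h) + η := by
    rw [Finset.eventually_all]
    intro i hi
    exact hkey _ _ (hA0 i hi) (hAB i) η hηpos
  obtain ⟨h, hh1, hh2⟩ := (hpsi.and hev).exists
  have hU : ∑ i ∈ Finset.range n, ∫⁻ x in Ioc (A i) (B i), d (v (x + h)) (v x) / ENNReal.ofReal h
      ≤ (ε / 4 : ℝ≥0) + (ε / 4 : ℝ≥0) := by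
    change (↑(Finset.range n) : Set ℕ).PairwiseDisjoint (fun i => Ioc (A i) (B i)) at hE2
    rw [← lintegral_biUnion_finset hE2 (fun i _ => measurableSet_Ioc)]
    refine (hM (fun x => d (v (x + h)) (v x) / ENNReal.ofReal h) _ ?_).trans ?_
    · refine le_trans (lintegral_mono_set ?_) hh1
      intro x hx
      simp only [mem_iUnion] at hx
      obtain ⟨i, hi, hx⟩ := hx
      exact lt_of_le_of_lt (hA0 i hi) hx.1
    · gcongr
      have hv : volume (⋃ i ∈ Finset.range n, Ioc (A i) (B i)) ≤
          ENNReal.ofReal (ε / 4 / (L * M + 1)) := by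
        refine (measure_biUnion_finset_le _ _).trans ?_
        simp only [Real.volume_Ioc]
        rw [← ENNReal.ofReal_sum_of_nonneg (fun i _ => sub_nonneg.2 (hAB i))]
        apply ENNReal.ofReal_le_ofReal
        refine le_trans (le_of_eq ?_) hlen.le
        refine Finset.sum_congr rfl fun i _ => ?_
        rw [Real.dist_eq, abs_sub_comm, max_sub_min_eq_abs]
      calc ((L * M : ℝ≥0) : ℝ≥0∞) * volume (⋃ i ∈ Finset.range n, Ioc (A i) (B i))
          ≤ (L * M : ℝ≥0) * ENNReal.ofReal (ε / 4 / (L * M + 1)) := by gcongr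
        _ ≤ _ := by
          rw [← ENNReal.ofReal_coe_nnreal, ← ENNReal.ofReal_coe_nnreal (p := ε / 4),
            ← ENNReal.ofReal_mul (by positivity)]
          apply ENNReal.ofReal_le_ofReal
          push_cast
          rw [mul_div_assoc', div_le_iff₀ (by positivity)]
          have : (0 : ℝ) ≤ L * M := by positivity
          have : (0 : ℝ) ≤ ε / 4 := by positivity
          nlinarith
  have hsum : ∑ i ∈ Finset.range n, d (v (I i).1) (v (I i).2) ≤
      (ε / 4 : ℝ≥0) + (ε / 4 : ℝ≥0) + (ε / 4 : ℝ≥0) := by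
    calc ∑ i ∈ Finset.range n, d (v (I i).1) (v (I i).2)
        ≤ ∑ i ∈ Finset.range n,
          ((∫⁻ x in Ioc (A i) (B i), d (v (x + h)) (v x) / ENNReal.ofReal h) + η) := by
          refine Finset.sum_le_sum fun i hi => ?_
          rw [hdAB]; exact hh2 i hi
      _ = (∑ i ∈ Finset.range n, ∫⁻ x in Ioc (A i) (B i), d (v (x + h)) (v x) / ENNReal.ofReal h)
          + (n * η : ℝ≥0) := by
          rw [Finset.sum_add_distrib]; simp
      _ ≤ _ := by
          gcongr
          rw [hη, mul_div_assoc', div_le_iff₀ (by positivity), mul_comm]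
          gcongr
          simp
  have hdist : ∀ i ∈ Finset.range n, dist (d (v s) (v (I i).1)).toReal (d (v s) (v (I i).2)).toReal
      ≤ (d (v (I i).1) (v (I i).2)).toReal := by
    intro i hi
    obtain ⟨⟨p1, _⟩, ⟨p2, _⟩⟩ := hE1 i (Finset.mem_range.1 hi)
    have q1 := hfin s (I i).1 hs (hs.trans p1)
    have q2 := hfin s (I i).2 hs (hs.trans p2)
    have q3 := hfin (I i).1 (I i).2 (hs.trans p1) (hs.trans p2)
    rw [Real.dist_eq, abs_sub_le_iff]
    constructor
    · rw [sub_le_iff_le_add, ← ENNReal.toReal_add q3 q2]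
      refine ENNReal.toReal_mono (by finiteness) ?_
      refine (htri _ (v (I i).2) _).trans (le_of_eq ?_)
      rw [hsymm (v (I i).2), add_comm]
    · rw [sub_le_iff_le_add, ← ENNReal.toReal_add q3 q1]
      refine ENNReal.toReal_mono (by finiteness) ?_
      refine (htri _ (v (I i).1) _).trans (le_of_eq ?_)
      rw [add_comm]
  calc ∑ i ∈ Finset.range n, dist (d (v s) (v (I i).1)).toReal (d (v s) (v (I i).2)).toReal
      ≤ ∑ i ∈ Finset.range n, (d (v (I i).1) (v (I i).2)).toReal := Finset.sum_le_sum hdist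
    _ = (∑ i ∈ Finset.range n, d (v (I i).1) (v (I i).2)).toReal := by
        rw [ENNReal.toReal_sum]
        intro i hi
        obtain ⟨⟨p1, _⟩, ⟨p2, _⟩⟩ := hE1 i (Finset.mem_range.1 hi)
        exact hfin _ _ (hs.trans p1) (hs.trans p2)
    _ ≤ ((ε / 4 : ℝ≥0) + (ε / 4 : ℝ≥0) + (ε / 4 : ℝ≥0) : ℝ≥0∞).toReal :=
        ENNReal.toReal_mono (by finiteness) hsum
    _ < ε := by
        rw [← ENNReal.coe_add, ← ENNReal.coe_add, ENNReal.coe_toReal]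
        have : (0 : ℝ) < ε := by exact_mod_cast hε
        push_cast
        linarith

/-- Lemma 2.1: a d-right continuous curve, continuous except at most a
countable set, with bounded difference quotients in `L^ψ`, is in `AC^ψ`. -/
theorem ac_of_difference_quotients {X : Type*} [TopologicalSpace X] [PolishSpace X]
    (d : X → X → ℝ≥0∞) (hX : IsExtPolish X d)
    (ψ : ℝ≥0∞ → ℝ≥0∞) (hψ : IsOrlicz ψ) (hsl : Superlinear ψ) (hfl : FlatAtZero ψ)
    (T : ℝ) (hT : 0 < T) (u : ℝ → X)
    (hext : ∀ t : ℝ, T ≤ t → u t = u T)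
    (hrc : ∀ t ∈ Icc (0 : ℝ) T, Tendsto (fun s => d (u s) (u t)) (𝓝[>] t) (𝓝 0))
    (hcc : ∃ S : Set ℝ, S.Countable ∧ ∀ t ∈ Icc (0 : ℝ) T \ S,
      Tendsto (fun s => d (u s) (u t)) (𝓝[Icc (0 : ℝ) T] t) (𝓝 0))
    (hbdd : Filter.limsup
        (fun h : ℝ => luxNorm ψ (volume.restrict (Icc (0 : ℝ) T))
          (fun t => d (u (t + h)) (u t) / ENNReal.ofReal h))
        (𝓝[>] (0 : ℝ)) < ⊤) :
    IsACpsi ψ d 0 T u := by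
  have hsymm := hX.symm
  have htri := hX.triangle
  have h0 : ∀ x, d x x = 0 := fun x => (hX.eq_zero_iff x x).2 rfl
  obtain ⟨S, hS, hSc⟩ := hcc
  set v : ℝ → X := fun t => u (max t 0) with hv
  have hvu : ∀ t, 0 ≤ t → v t = u t := fun t ht => by simp [hv, ht]
  have hvT : ∀ t, T ≤ t → v t = u T := fun t ht => by
    rw [hvu t (hT.le.trans ht), hext t ht]
  have hrcv : ∀ t, 0 ≤ t → Tendsto (fun s => d (v s) (v t)) (𝓝[>] t) (𝓝 0) := by
    intro t ht
    rcases le_total T t with h | h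
    · refine Tendsto.congr' ?_ tendsto_const_nhds
      filter_upwards [self_mem_nhdsWithin] with s hs
      rw [mem_Ioi] at hs
      rw [hvT t h, hvT s (h.trans hs.le), h0]
    · refine Tendsto.congr' ?_ (hrc t ⟨ht, h⟩)
      filter_upwards [self_mem_nhdsWithin] with s hs
      rw [mem_Ioi] at hs
      rw [hvu t ht, hvu s (ht.trans hs.le)]
  have hcv : ∀ t, t ∉ S ∪ {0, T} → Tendsto (fun s => d (v s) (v t)) (𝓝 t) (𝓝 0) := by
    intro t ht
    simp only [mem_union, mem_insert_iff, mem_singleton_iff, not_or] at ht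
    obtain ⟨ht1, ht2, ht3⟩ := ht
    rcases lt_or_gt_of_ne ht2 with h | h
    · refine Tendsto.congr' ?_ tendsto_const_nhds
      filter_upwards [Iio_mem_nhds h] with s hs
      rw [mem_Iio] at hs
      simp [hv, h.le, hs.le, h0]
    rcases lt_or_gt_of_ne ht3 with h' | h'
    · have hmem : Icc (0 : ℝ) T ∈ 𝓝 t := Icc_mem_nhds h h'
      have := hSc t ⟨⟨h.le, h'.le⟩, ht1⟩
      rw [nhdsWithin_eq_nhds.2 hmem] at this
      refine Tendsto.congr' ?_ this
      filter_upwards [hmem] with s hs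
      rw [hvu t h.le, hvu s hs.1]
    · refine Tendsto.congr' ?_ tendsto_const_nhds
      filter_upwards [Ioi_mem_nhds h'] with s hs
      rw [mem_Ioi] at hs
      rw [hvT t h'.le, hvT s hs.le, h0]
  have hm := aux_aemeas d hsymm htri v (S ∪ {0, T}) (hS.union (Set.toFinite _).countable) hcv
  obtain ⟨L, hL1, -⟩ := ENNReal.lt_iff_exists_nnreal_btwn.1 hbdd
  have hL : 0 < L := by
    have := lt_of_le_of_lt (zero_le) hL1
    exact_mod_cast this
  have hL0 : (L : ℝ≥0∞) ≠ 0 := by exact_mod_cast hL.ne'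
  have hpsi : ∀ᶠ h : ℝ in 𝓝[>] 0,
      ∫⁻ x in Ioi (0 : ℝ), ψ (d (v (x + h)) (v x) / ENNReal.ofReal h / L) ≤ 1 := by
    filter_upwards [eventually_lt_of_limsup_lt hL1, self_mem_nhdsWithin] with h hh hpos
    rw [mem_Ioi] at hpos
    unfold luxNorm at hh
    rw [sInf_lt_iff] at hh
    obtain ⟨l, ⟨hl0, hl1⟩, hlL⟩ := hh
    have hsub : Ioi (0 : ℝ) ⊆ Icc 0 T ∪ Ioi T := by
      intro x hx
      rcases le_or_gt x T with h' | h'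
      · exact Or.inl ⟨le_of_lt hx, h'⟩
      · exact Or.inr h'
    refine (lintegral_mono_set hsub).trans ((lintegral_union_le _ _ _).trans ?_)
    have z : ∫⁻ x in Ioi T, ψ (d (v (x + h)) (v x) / ENNReal.ofReal h / L) = 0 := by
      rw [setLIntegral_congr_fun (g := fun _ => 0) measurableSet_Ioi]
      · simp
      · intro x hx
        rw [mem_Ioi] at hx
        simp only
        rw [hvT x hx.le, hvT (x + h) (by linarith), h0]
        simp [hψ.zero]
    rw [z, add_zero]
    refine le_trans (setLIntegral_mono_ae' measurableSet_Icc (ae_of_all _ ?_)) hl1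
    intro x hx
    rw [hvu x hx.1, hvu (x + h) (by linarith [hx.1])]
    apply hψ.mono
    gcongr
  have hkey := aux_key d h0 hsymm htri v hm hrcv ψ hψ hsl L hL hpsi
  set hn : ℕ → ℝ := fun n => 1 / ((n : ℝ) + 1) with hhn
  have hnpos : ∀ n, 0 < hn n := fun n => by positivity
  have hnlim : Tendsto hn atTop (𝓝[>] 0) :=
    tendsto_nhdsWithin_iff.2 ⟨tendsto_one_div_add_atTop_nhds_zero_nat, Eventually.of_forall hnpos⟩
  set g : ℕ → ℝ → ℝ≥0∞ := fun n x => d (v (x + hn n)) (v x) / ENNReal.ofReal (hn n) / L with hg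
  refine ⟨fun x => L * liminf (fun n => g n x) atTop, ?_, ?_⟩
  · refine lt_of_le_of_lt (sInf_le (a := (L : ℝ≥0∞)) ?_) coe_lt_top
    refine ⟨by exact_mod_cast hL, ?_⟩
    have hdiv : ∀ y : ℝ≥0∞, L * y / L = y := fun y => by
      rw [mul_comm, ENNReal.mul_div_cancel_right hL0 coe_ne_top]
    simp_rw [hdiv]
    rw [← Measure.restrict_congr_set Ioc_ae_eq_Icc]
    refine (lintegral_mono_set (fun x hx => hx.1 : Ioc (0 : ℝ) T ⊆ Ioi 0)).trans ?_
    refine (lintegral_mono fun x => aux_lsc ψ hψ _).trans ?_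
    refine (lintegral_liminf_le' fun n => ?_).trans ?_
    · exact hψ.mono.measurable.comp_aemeasurable
        (((hm (hn n)).div_const _).div_const _).restrict
    · refine liminf_le_of_frequently_le' ?_
      exact (hnlim.eventually hpsi).frequently
  · intro s t hs hst htT
    obtain ⟨hfin, hac⟩ := aux_ac d hsymm htri v ψ hψ hsl L hL hpsi hkey s t hs hst
    set φ : ℝ → ℝ := fun x => (d (v s) (v x)).toReal with hφ
    have hftc := hac.integral_deriv_eq_sub
    have hφs : φ s = 0 := by simp [hφ, h0]
    rw [hφs, sub_zero, intervalIntegral.integral_of_le hst] at hftc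
    rw [← hvu s hs, ← hvu t (hs.trans hst), ← ENNReal.ofReal_toReal (hfin s t hs (hs.trans hst))]
    change ENNReal.ofReal (φ t) ≤ _
    rw [← hftc, ← Measure.restrict_congr_set Ioc_ae_eq_Icc]
    refine (ENNReal.ofReal_le_ofReal (le_abs_self _)).trans ?_
    rw [← Real.norm_eq_abs, ofReal_norm]
    refine (enorm_integral_le_lintegral_enorm _).trans ?_
    refine setLIntegral_mono_ae' measurableSet_Ioc ?_
    filter_upwards [hac.ae_differentiableAt] with x hx hxm
    have hx0 : 0 ≤ x := hs.trans hxm.1.le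
    have hdx := hx (by rw [uIcc_of_le hst]; exact Ioc_subset_Icc_self hxm)
    have hsl := (hdx.hasDerivAt.tendsto_slope_zero_right.comp hnlim).enorm
    have hsl2 := ENNReal.Tendsto.div_const hsl (Or.inr hL0)
    have hle : ‖deriv φ x‖ₑ / L ≤ liminf (fun n => g n x) atTop := by
      rw [← hsl2.liminf_eq]
      refine liminf_le_liminf (Eventually.of_forall fun n => ?_)
      simp only [hg, Function.comp]
      gcongr
      have hxn : 0 ≤ x + hn n := add_nonneg hx0 (hnpos n).le
      have q1 := hfin s x hs hx0
      have q2 := hfin s (x + hn n) hs hxn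
      have q3 := hfin (x + hn n) x hxn hx0
      have habs : |φ (x + hn n) - φ x| ≤ (d (v (x + hn n)) (v x)).toReal := by
        rw [abs_sub_le_iff]
        constructor
        · rw [sub_le_iff_le_add, hφ, ← ENNReal.toReal_add q3 q1]
          refine ENNReal.toReal_mono (by finiteness) ?_
          refine (htri _ (v x) _).trans (le_of_eq ?_)
          rw [hsymm (v x), add_comm]
        · rw [sub_le_iff_le_add, hφ, ← ENNReal.toReal_add q3 q2]
          refine ENNReal.toReal_mono (by finiteness) ?_
          refine (htri _ (v (x + hn n)) _).trans (le_of_eq ?_)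
          rw [add_comm]
      rw [← ofReal_norm, norm_smul, norm_inv, Real.norm_of_nonneg (hnpos n).le, Real.norm_eq_abs,
        ← ENNReal.ofReal_toReal q3, ← ENNReal.ofReal_div_of_pos (hnpos n)]
      apply ENNReal.ofReal_le_ofReal
      rw [inv_mul_eq_div]
      have := hnpos n
      gcongr
    rw [ENNReal.div_le_iff hL0 coe_ne_top, mul_comm] at hle
    exact hle
end
end

section
/- If (X,d) is a complete extended metric space (within an extended Polish structure (X,τ,d)), then the Wasserstein–Orlicz space (P(X), W_ψ) is a complete extended metric space. -/
open MeasureTheory Filter Set ENNReal NNReal Topology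

noncomputable section

section helpers

open ProbabilityTheory

/-- There is a plan between `μ` and `ν` with Orlicz energy at scale `ε` at most one. -/
def CloseAt (ψ : ℝ≥0∞ → ℝ≥0∞) {X : Type*} [MeasurableSpace X] (d : X → X → ℝ≥0∞)
    (μ ν : Measure X) (ε : ℝ≥0∞) : Prop :=
  ∃ γ ∈ Couplings μ ν, ∫⁻ p, ψ (d p.1 p.2 / ε) ∂γ ≤ 1

lemma closeAt_of_wass_lt {ψ : ℝ≥0∞ → ℝ≥0∞} (hψ : IsOrlicz ψ) {X : Type*} [MeasurableSpace X]
    {d : X → X → ℝ≥0∞} {μ ν : Measure X} {ε : ℝ≥0∞} (h : Wass ψ d μ ν < ε) :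
    CloseAt ψ d μ ν ε := by
  unfold Wass at h
  simp only [iInf_lt_iff] at h
  obtain ⟨γ, hγ, h⟩ := h
  unfold luxNorm at h
  rw [sInf_lt_iff] at h
  obtain ⟨l, ⟨_, hl⟩, hlt⟩ := h
  refine ⟨γ, hγ, le_trans (lintegral_mono fun p => hψ.mono ?_) hl⟩
  exact ENNReal.div_le_div_left hlt.le _

lemma wass_le_of_closeAt {ψ : ℝ≥0∞ → ℝ≥0∞} {X : Type*} [MeasurableSpace X]
    {d : X → X → ℝ≥0∞} {μ ν : Measure X} {ε : ℝ≥0∞} (hε : 0 < ε) (h : CloseAt ψ d μ ν ε) :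
    Wass ψ d μ ν ≤ ε := by
  obtain ⟨γ, hγ, h⟩ := h
  exact (iInf₂_le γ hγ).trans (sInf_le ⟨hε, h⟩)

lemma exists_chain {X : Type*} [MeasurableSpace X] [StandardBorelSpace X] [Nonempty X]
    (γ : ℕ → Measure (X × X)) (hγ : ∀ n, IsProbabilityMeasure (γ n))
    (hc : ∀ n, (γ n).map Prod.snd = (γ (n + 1)).map Prod.fst) :
    ∃ P : Measure (ℕ → X), IsProbabilityMeasure P ∧
      ∀ n, P.map (fun x => (x n, x (n + 1))) = γ n := by
  let κ : (n : ℕ) → Kernel ((i : Finset.Iic n) → X) X := fun n =>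
    (γ n).condKernel.comap (fun x => x ⟨n, Finset.mem_Iic.2 le_rfl⟩) (by fun_prop)
  have : ∀ n, IsMarkovKernel (κ n) := fun n => by dsimp only [κ]; infer_instance
  have h0 : IsProbabilityMeasure ((γ 0).map Prod.fst) :=
    Measure.isProbabilityMeasure_map (by fun_prop)
  let P : Measure (ℕ → X) := Kernel.trajMeasure (X := fun _ => X) ((γ 0).map Prod.fst) κ
  have step : ∀ n, P.map (fun x => x n) = (γ n).map Prod.fst →
      P.map (fun x => (x n, x (n + 1))) = γ n := by
    intro n hn
    have key := Kernel.map_frestrictLe_trajMeasure_compProd_eq_map_trajMeasure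
      (X := fun _ => X) (μ₀ := (γ 0).map Prod.fst) (κ := κ) (a := n)
    have e1 : P.map (fun x => (x n, x (n + 1))) =
        (P.map (fun x => (Preorder.frestrictLe (π := fun _ => X) n x, x (n + 1)))).map
          (fun q => (q.1 ⟨n, Finset.mem_Iic.2 le_rfl⟩, q.2)) := by
      rw [Measure.map_map (by fun_prop) (by fun_prop)]
      rfl
    rw [e1]
    have key' : P.map (fun x => (Preorder.frestrictLe (π := fun _ => X) n x, x (n + 1))) =
      P.map (Preorder.frestrictLe (π := fun _ => X) n) ⊗ₘ κ n := key.symm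
    rw [key']
    conv_rhs => rw [← (γ n).disintegrate (γ n).condKernel]
    have : IsProbabilityMeasure P := by dsimp only [P]; infer_instance
    ext s hs
    rw [Measure.map_apply (by fun_prop) hs, Measure.compProd_apply (by
        exact hs.preimage (by fun_prop)), Measure.compProd_apply hs, lintegral_map
        (Kernel.measurable_kernel_prodMk_left (hs.preimage (by fun_prop))) (by fun_prop), Measure.fst, ← hn,
      lintegral_map (Kernel.measurable_kernel_prodMk_left hs) (by fun_prop)]
    rfl
  have hP : IsProbabilityMeasure P := by dsimp only [P]; infer_instance
  have base : P.map (fun x => x 0) = (γ 0).map Prod.fst := by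
    have : P.map (fun x => x 0) =
        (P.map (Preorder.frestrictLe (π := fun _ => X) 0)).map
          (fun q => q ⟨0, Finset.mem_Iic.2 le_rfl⟩) := by
      rw [Measure.map_map (by fun_prop) (by fun_prop)]
      rfl
    rw [this]
    dsimp only [P]
    rw [Kernel.trajMeasure, Measure.map_comp _ _ (by fun_prop), Kernel.traj_map_frestrictLe,
      Kernel.partialTraj_self, Measure.id_comp, Measure.map_map (by fun_prop) (by fun_prop)]
    exact Measure.map_id
  refine ⟨P, hP, fun n => step n ?_⟩
  induction n with
  | zero => exact base
  | succ n ih =>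
    rw [← hc n, ← step n ih, Measure.map_map (by fun_prop) (by fun_prop)]
    rfl

lemma jensen_fin {ψ : ℝ≥0∞ → ℝ≥0∞} (hψ : IsOrlicz ψ) (n : ℕ) : ∀ a : ℕ → ℝ≥0∞,
    ψ (∑ k ∈ Finset.range n, 2⁻¹ ^ (k + 1) * a k) ≤
      ∑ k ∈ Finset.range n, 2⁻¹ ^ (k + 1) * ψ (a k) := by
  induction n with
  | zero => intro a; simp [hψ.zero]
  | succ n ih =>
    intro a
    have e : ∀ b : ℕ → ℝ≥0∞, ∑ k ∈ Finset.range (n + 1), 2⁻¹ ^ (k + 1) * b k =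
        2⁻¹ * b 0 + 2⁻¹ * ∑ k ∈ Finset.range n, 2⁻¹ ^ (k + 1) * b (k + 1) := by
      intro b
      rw [Finset.sum_range_succ', Finset.mul_sum, add_comm]
      congr 1
      · simp
      · exact Finset.sum_congr rfl fun k _ => by rw [pow_succ' _ (k + 1), mul_assoc]
    rw [e a, e fun k => ψ (a k)]
    refine (hψ.convex _ _ _ _ ENNReal.inv_two_add_inv_two).trans ?_
    gcongr
    exact ih fun k => a (k + 1)

lemma jensen_inf {ψ : ℝ≥0∞ → ℝ≥0∞} (hψ : IsOrlicz ψ) (a : ℕ → ℝ≥0∞) :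
    ψ (∑' k, 2⁻¹ ^ (k + 1) * a k) ≤ ∑' k, 2⁻¹ ^ (k + 1) * ψ (a k) := by
  refine le_of_forall_lt fun y hy => ?_
  have h1 := hψ.lsc _ y hy
  have h2 := (ENNReal.summable (f := fun k => 2⁻¹ ^ (k + 1) * a k)).hasSum.tendsto_sum_nat
  obtain ⟨n, hn⟩ := (h2.eventually h1).exists
  exact hn.trans_le ((jensen_fin hψ n a).trans (ENNReal.sum_le_tsum _))

lemma tsum_half_pow : ∑' k : ℕ, (2⁻¹ : ℝ≥0∞) ^ (k + 1) = 1 := by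
  simp only [pow_succ]
  rw [ENNReal.tsum_mul_right, ENNReal.tsum_geometric, ENNReal.one_sub_inv_two, inv_inv]
  exact ENNReal.mul_inv_cancel (by simp) (by simp)

lemma energy_tsum {ψ : ℝ≥0∞ → ℝ≥0∞} (hψ : IsOrlicz ψ) {Ω : Type*} [MeasurableSpace Ω]
    (P : Measure Ω) (f : ℕ → Ω → ℝ≥0∞) (hf : ∀ k, Measurable (f k)) (ε : ℝ≥0∞)
    (h : ∀ k, ∫⁻ ω, ψ (f k ω / (2⁻¹ ^ (k + 1) * ε)) ∂P ≤ 1) :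
    ∫⁻ ω, ψ ((∑' k, f k ω) / ε) ∂P ≤ 1 := by
  have hm : Measurable ψ := hψ.mono.measurable
  calc ∫⁻ ω, ψ ((∑' k, f k ω) / ε) ∂P
      ≤ ∫⁻ ω, ∑' k, 2⁻¹ ^ (k + 1) * ψ (f k ω / (2⁻¹ ^ (k + 1) * ε)) ∂P := by
        refine lintegral_mono fun ω => ?_
        refine le_trans (le_of_eq ?_) (jensen_inf hψ _)
        congr 1
        rw [div_eq_mul_inv, ← ENNReal.tsum_mul_right]
        refine tsum_congr fun k => ?_
        have h0 : (2⁻¹ : ℝ≥0∞) ^ (k + 1) ≠ 0 := by simp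
        have ht : (2⁻¹ : ℝ≥0∞) ^ (k + 1) ≠ ⊤ := by simp
        rw [div_eq_mul_inv, ENNReal.mul_inv (Or.inl h0) (Or.inl ht), ← mul_assoc, ← mul_assoc,
          mul_comm _ (f k ω), mul_assoc (f k ω), ENNReal.mul_inv_cancel h0 ht, mul_one]
    _ = ∑' k, 2⁻¹ ^ (k + 1) * ∫⁻ ω, ψ (f k ω / (2⁻¹ ^ (k + 1) * ε)) ∂P := by
        rw [lintegral_tsum]
        · refine tsum_congr fun k => lintegral_const_mul _ ?_
          exact hm.comp ((hf k).div_const _)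
        · intro k
          exact ((hm.comp ((hf k).div_const _)).const_mul _).aemeasurable
    _ ≤ ∑' k : ℕ, 2⁻¹ ^ (k + 1) * 1 := ENNReal.tsum_le_tsum fun k => by gcongr; exact h k
    _ = 1 := by simp only [mul_one]; exact tsum_half_pow

variable {X : Type*} [TopologicalSpace X] [PolishSpace X] [MeasurableSpace X] [BorelSpace X]

lemma measurable_d {d : X → X → ℝ≥0∞} (hX : IsExtPolish X d) :
    Measurable fun p : X × X => d p.1 p.2 := hX.lsc.measurable

lemma closeAt_trans {d : X → X → ℝ≥0∞} (hX : IsExtPolish X d)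
    {ψ : ℝ≥0∞ → ℝ≥0∞} (hψ : IsOrlicz ψ) {μ ν ρ : Measure X} {ε : ℝ≥0∞}
    (h1 : CloseAt ψ d μ ν ε) (h2 : CloseAt ψ d ν ρ ε) : CloseAt ψ d μ ρ (2 * ε) := by
  obtain ⟨γ1, ⟨hp1, hf1, hs1⟩, hi1⟩ := h1
  obtain ⟨γ2, ⟨hp2, hf2, hs2⟩, hi2⟩ := h2
  have hρ : IsProbabilityMeasure ρ := hs2 ▸ Measure.isProbabilityMeasure_map (by fun_prop)
  have hm : Measurable ψ := hψ.mono.measurable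
  have hd := measurable_d hX
  have : Nonempty X := ρ.nonempty_of_neZero
  let γ : ℕ → Measure (X × X) := fun n => match n with
    | 0 => γ1
    | 1 => γ2
    | _ + 2 => ρ.map (fun x => (x, x))
  obtain ⟨P, hP, hPγ⟩ := exists_chain γ
    (fun n => match n with
      | 0 => hp1
      | 1 => hp2
      | _ + 2 => Measure.isProbabilityMeasure_map (by fun_prop))
    (fun n => match n with
      | 0 => by simp only [γ]; rw [hs1, hf2]
      | 1 => by
        simp only [γ]; rw [hs2, Measure.map_map (by fun_prop) (by fun_prop)]
        exact Measure.map_id.symm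
      | _ + 2 => by
        simp only [γ]
        rw [Measure.map_map (by fun_prop) (by fun_prop), Measure.map_map (by fun_prop) (by fun_prop)]
        rfl)
  have e1 : P.map (fun x => (x 0, x 1)) = γ1 := hPγ 0
  have e2 : P.map (fun x => (x 1, x 2)) = γ2 := hPγ 1
  refine ⟨P.map (fun x => (x 0, x 2)), ⟨Measure.isProbabilityMeasure_map (by fun_prop), ?_, ?_⟩, ?_⟩
  · rw [← hf1, ← e1, Measure.map_map (by fun_prop) (by fun_prop),
      Measure.map_map (by fun_prop) (by fun_prop)]
    rfl
  · rw [← hs2, ← e2, Measure.map_map (by fun_prop) (by fun_prop),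
      Measure.map_map (by fun_prop) (by fun_prop)]
    rfl
  have hg : ∀ c, Measurable fun p : X × X => ψ (d p.1 p.2 / c) := fun c =>
    hm.comp (hd.div_const _)
  rw [← e1, lintegral_map (hg _) (by fun_prop)] at hi1
  rw [← e2, lintegral_map (hg _) (by fun_prop)] at hi2
  rw [lintegral_map (hg _) (by fun_prop)]
  calc ∫⁻ x, ψ (d (x 0) (x 2) / (2 * ε)) ∂P
      ≤ ∫⁻ x : ℕ → X, (2⁻¹ * ψ (d (x 0) (x 1) / ε) + 2⁻¹ * ψ (d (x 1) (x 2) / ε)) ∂P := by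
        refine lintegral_mono fun x => ?_
        refine le_trans (hψ.mono ?_) (hψ.convex _ _ _ _ ENNReal.inv_two_add_inv_two)
        rw [← mul_add, ← ENNReal.add_div, div_eq_mul_inv, div_eq_mul_inv,
          ENNReal.mul_inv (by simp) (by simp), mul_left_comm]
        gcongr
        exact hX.triangle _ _ _
    _ = 2⁻¹ * ∫⁻ x : ℕ → X, ψ (d (x 0) (x 1) / ε) ∂P +
        2⁻¹ * ∫⁻ x : ℕ → X, ψ (d (x 1) (x 2) / ε) ∂P := by
        have m1 : Measurable fun x : ℕ → X => ψ (d (x 0) (x 1) / ε) :=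
          (hg ε).comp (g := fun p : X × X => ψ (d p.1 p.2 / ε)) (f := fun x : ℕ → X => (x 0, x 1)) (by fun_prop)
        have m2 : Measurable fun x : ℕ → X => ψ (d (x 1) (x 2) / ε) :=
          (hg ε).comp (g := fun p : X × X => ψ (d p.1 p.2 / ε)) (f := fun x : ℕ → X => (x 1, x 2)) (by fun_prop)
        rw [lintegral_add_left (m1.const_mul _), lintegral_const_mul _ m1, lintegral_const_mul _ m2]
    _ ≤ 2⁻¹ * 1 + 2⁻¹ * 1 := by gcongr
    _ = 1 := by simp [ENNReal.inv_two_add_inv_two]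

lemma d_le_sum {d : X → X → ℝ≥0∞} (hX : IsExtPolish X d) (x : ℕ → X) (n m : ℕ) :
    d (x n) (x (n + m)) ≤ ∑ k ∈ Finset.range m, d (x (n + k)) (x (n + k + 1)) := by
  induction m with
  | zero => simp [(hX.eq_zero_iff (x n) (x n)).2 rfl]
  | succ m ih =>
    rw [Finset.sum_range_succ]
    exact (hX.triangle _ _ _).trans (add_le_add_left ih _)

lemma d_le_tsum {d : X → X → ℝ≥0∞} (hX : IsExtPolish X d) (x : ℕ → X) (n m : ℕ) (h : n ≤ m) :
    d (x n) (x m) ≤ ∑' k, d (x (k + n)) (x (k + n + 1)) := by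
  obtain ⟨m, rfl⟩ := Nat.exists_eq_add_of_le h
  refine (d_le_sum hX x n m).trans ?_
  simp only [add_comm n]
  exact ENNReal.sum_le_tsum (f := fun k => d (x (k + n)) (x (k + n + 1))) _

lemma exists_lim {d : X → X → ℝ≥0∞} (hX : IsExtPolish X d) (x : ℕ → X)
    (hx : ∑' k, d (x k) (x (k + 1)) ≠ ⊤) :
    ∃ y, Tendsto x atTop (𝓝 y) ∧
      ∀ n, d (x n) y ≤ ∑' k, d (x (k + n)) (x (k + n + 1)) := by
  have ht := ENNReal.tendsto_sum_nat_add (fun k => d (x k) (x (k + 1))) hx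
  obtain ⟨y, hy⟩ := hX.complete x (by
    intro ε hε
    obtain ⟨N, hN⟩ := (ht.eventually (gt_mem_nhds (ENNReal.half_pos hε.ne'))).exists
    refine ⟨N, fun m n hm hn => ?_⟩
    refine (hX.triangle _ (x N) _).trans_lt ?_
    rw [hX.symm (x m)]
    refine lt_of_lt_of_eq (ENNReal.add_lt_add ((d_le_tsum hX x N m hm).trans_lt hN)
      ((d_le_tsum hX x N n hn).trans_lt hN)) (ENNReal.add_halves _))
  refine ⟨y, hX.compat _ _ hy, fun n => ?_⟩
  have h2 : Tendsto (fun m => (∑' k, d (x (k + n)) (x (k + n + 1))) + d (x m) y) atTop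
      (𝓝 ((∑' k, d (x (k + n)) (x (k + n + 1))) + 0)) := tendsto_const_nhds.add hy
  rw [add_zero] at h2
  refine ge_of_tendsto h2 ((eventually_ge_atTop n).mono fun m hm => ?_)
  exact (hX.triangle _ (x m) _).trans (add_le_add_left (d_le_tsum hX x n m hm) _)

lemma psi_top {ψ : ℝ≥0∞ → ℝ≥0∞} (hψ : IsOrlicz ψ) : ψ ⊤ = ⊤ := by
  obtain ⟨M, hM⟩ := hψ.tendsto_top ⊤
  exact top_le_iff.1 (hM ⊤ le_top)

lemma exists_limit_measure {d : X → X → ℝ≥0∞} (hX : IsExtPolish X d)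
    {ψ : ℝ≥0∞ → ℝ≥0∞} (hψ : IsOrlicz ψ) (μ : ℕ → Measure X)
    (h : ∀ k, CloseAt ψ d (μ k) (μ (k + 1)) (2⁻¹ ^ (k + 1))) :
    ∃ ν : Measure X, IsProbabilityMeasure ν ∧ ∀ k, CloseAt ψ d (μ k) ν (2⁻¹ ^ k) := by
  have hm : Measurable ψ := hψ.mono.measurable
  have hd := measurable_d hX
  choose γ hγ hi using h
  have : Nonempty X := by
    have := (hγ 0).1
    exact (γ 0).nonempty_of_neZero.map Prod.fst
  obtain ⟨P, hP, hPγ⟩ := exists_chain γ (fun n => (hγ n).1) (fun n => by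
    rw [(hγ n).2.2, (hγ (n + 1)).2.1])
  have hg : ∀ c, Measurable fun p : X × X => ψ (d p.1 p.2 / c) := fun c =>
    hm.comp (hd.div_const _)
  have hdm : ∀ n, Measurable fun x : ℕ → X => d (x n) (x (n + 1)) := fun n =>
    hd.comp (g := fun p : X × X => d p.1 p.2) (f := fun x : ℕ → X => (x n, x (n + 1))) (by fun_prop)
  have hE : ∀ n, ∫⁻ x : ℕ → X, ψ ((∑' k, d (x (k + n)) (x (k + n + 1))) / 2⁻¹ ^ n) ∂P ≤ 1 := by
    intro n
    refine energy_tsum hψ P (fun k x => d (x (k + n)) (x (k + n + 1))) (fun k => hdm _) _ fun k => ?_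
    have := hi (k + n)
    rw [← hPγ, lintegral_map (hg _) (by fun_prop)] at this
    rw [← pow_add]
    convert this using 6
    omega
  have hfin : ∀ᵐ x ∂P, ∑' k, d (x k) (x (k + 1)) ≠ ⊤ := by
    have h0 := hE 0
    simp only [add_zero, pow_zero, div_one] at h0
    have hmeas : Measurable fun x : ℕ → X => ψ (∑' k, d (x k) (x (k + 1))) :=
      hm.comp (Measurable.ennreal_tsum hdm)
    filter_upwards [ae_lt_top hmeas (h0.trans_lt one_lt_top).ne] with x hx hx'
    rw [hx', psi_top hψ] at hx
    exact lt_irrefl _ hx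
  obtain ⟨L, hL, hLt⟩ := measurable_limit_of_tendsto_metrizable_ae (μ := P) (L := atTop)
    (f := fun n (x : ℕ → X) => x n) (fun n => (measurable_pi_apply n).aemeasurable)
    (by
      filter_upwards [hfin] with x hx
      obtain ⟨y, hy, _⟩ := exists_lim hX x hx
      exact ⟨y, hy⟩)
  refine ⟨P.map L, Measure.isProbabilityMeasure_map hL.aemeasurable, fun k => ?_⟩
  have hpair : Measurable fun x : ℕ → X => (x k, L x) := (measurable_pi_apply k).prodMk hL
  refine ⟨P.map (fun x => (x k, L x)), ⟨Measure.isProbabilityMeasure_map hpair.aemeasurable,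
    ?_, ?_⟩, ?_⟩
  · rw [← (hγ k).2.1, ← hPγ k, Measure.map_map (by fun_prop) hpair,
      Measure.map_map (by fun_prop) (by fun_prop)]
    rfl
  · rw [Measure.map_map (by fun_prop) hpair]
    rfl
  · rw [lintegral_map (hg _) hpair]
    refine le_trans (lintegral_mono_ae ?_) (hE k)
    filter_upwards [hfin, hLt] with x hx hLx
    obtain ⟨y, hy, hdy⟩ := exists_lim hX x hx
    obtain rfl : y = L x := tendsto_nhds_unique hy hLx
    exact hψ.mono (ENNReal.div_le_div_right (hdy k) _)

end helpers

/-- completeness of the extended Wasserstein–Orlicz space `(P(X), W_ψ)`. -/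
theorem wass_complete {X : Type*} [TopologicalSpace X] [PolishSpace X]
    [MeasurableSpace X] [BorelSpace X]
    (d : X → X → ℝ≥0∞) (hX : IsExtPolish X d)
    (ψ : ℝ≥0∞ → ℝ≥0∞) (hψ : IsOrlicz ψ)
    (μ : ℕ → Measure X) (hprob : ∀ n, IsProbabilityMeasure (μ n))
    (hcauchy : ∀ ε : ℝ≥0∞, 0 < ε → ∃ N, ∀ m n, N ≤ m → N ≤ n →
      Wass ψ d (μ m) (μ n) < ε) :
    ∃ ν : Measure X, IsProbabilityMeasure ν ∧
      Tendsto (fun n => Wass ψ d (μ n) ν) atTop (𝓝 0) := by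
  have hpos : ∀ k : ℕ, 0 < (2⁻¹ : ℝ≥0∞) ^ k := fun k => by
    rw [pos_iff_ne_zero]; simp
  choose N hN using fun k : ℕ => hcauchy (2⁻¹ ^ (k + 1)) (hpos _)
  let φ : ℕ → ℕ := fun k => ∑ j ∈ Finset.range (k + 1), N j
  have hφ : ∀ k, N k ≤ φ k := fun k =>
    Finset.single_le_sum (f := N) (fun _ _ => Nat.zero_le _) (Finset.self_mem_range_succ k)
  have hφ' : ∀ k, φ k ≤ φ (k + 1) := fun k => by
    dsimp only [φ]
    rw [Finset.sum_range_succ _ (k + 1)]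
    exact Nat.le_add_right _ _
  obtain ⟨ν, hν, hc⟩ := exists_limit_measure hX hψ (fun k => μ (φ k)) (fun k =>
    closeAt_of_wass_lt hψ (hN k _ _ (hφ k) ((hφ k).trans (hφ' k))))
  refine ⟨ν, hν, ?_⟩
  have hlim : Tendsto (fun k : ℕ => 2 * (2⁻¹ : ℝ≥0∞) ^ k) atTop (𝓝 (2 * 0)) :=
    ENNReal.Tendsto.const_mul
      (ENNReal.tendsto_pow_atTop_nhds_zero_of_lt_one (by simp)) (Or.inr (by simp))
  rw [mul_zero] at hlim
  rw [ENNReal.tendsto_nhds_zero]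
  intro ε hε
  obtain ⟨k, hk⟩ := (hlim.eventually (gt_mem_nhds hε)).exists
  refine (eventually_ge_atTop (N k)).mono fun n hn => ?_
  refine le_trans (wass_le_of_closeAt ?_ (closeAt_trans hX hψ (closeAt_of_wass_lt hψ ?_) (hc k))) hk.le
  · exact ENNReal.mul_pos (by simp) (hpos k).ne'
  · refine (hN k n (φ k) hn (hφ k)).trans_le ?_
    exact pow_le_pow_right_of_le_one' (by simp) (Nat.le_succ k)
end
end
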